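/- An element D of the Enriques lattice Λ satisfies Q(D − 2Δ) = −2 and Q(D − 4Δ) = −2 if and only if there is a permutation σ of the indices {1,…,10} such that the vector (D_{σ(1)},…,D_{σ(10)}) equals one of the seven vectors (4,1,1,1,1,1,1,0,0,0), (3,3,1,1,1,1,0,0,0,0), (3,2,2,2,1,0,0,0,0,0), (3,2,2,1,1,1,1,0,0,−1), (2,2,2,2,2,1,0,0,0,−1), (2,2,2,2,1,1,1,1,−1,−1), (2,2,2,1,1,1,1,1,1,−2). In other words, these are exactly the Ulrich divisors for H = 2Δ up to permutations of the Eᵢ. -/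

import Mathlib

/-- The bilinear form `B(a,b) = (Σᵢ aᵢ)(Σⱼ bⱼ) − Σᵢ aᵢbᵢ` on `ℚ^10`. -/
def B (a b : Fin 10 → ℚ) : ℚ :=
  (∑ i, a i) * (∑ j, b j) - ∑ i, a i * b i

/-- The associated quadratic form `Q(a) = B(a,a)`. -/
def Q (a : Fin 10 → ℚ) : ℚ := B a a

/-- Membership in the Enriques lattice
`Λ = {a ∈ ℚ^10 : 3aᵢ ∈ ℤ for all i, and aᵢ − aⱼ ∈ ℤ for all i, j}`. -/
def inLambda (a : Fin 10 → ℚ) : Prop :=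
  (∀ i, ∃ n : ℤ, 3 * a i = (n : ℚ)) ∧ ∀ i j, ∃ n : ℤ, a i - a j = (n : ℚ)

/-- The standard basis vector `Eᵢ` of `ℚ^10`. -/
def E (i : Fin 10) : Fin 10 → ℚ := fun j => if j = i then 1 else 0

/-- The Fano class `Δ = (1/3)(E₁ + ⋯ + E₁₀)`. -/
def Δ : Fin 10 → ℚ := fun _ => 1 / 3

/-- Both Ulrich conditions depend on `D` only through its coordinate sum and sum of squares. -/
theorem Q_sub_smul_Δ (D : Fin 10 → ℚ) (c : ℚ) :
    Q (D - c • Δ) = (∑ i, D i) ^ 2 - ∑ i, D i ^ 2 - 6 * c * ∑ i, D i + 10 * c ^ 2 := by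
  simp only [Q, B, Δ, Pi.sub_apply, Pi.smul_apply, smul_eq_mul, Fin.sum_univ_succ,
    Fin.sum_univ_zero]
  ring

theorem ulrich_double_fano_iff_sums (D : Fin 10 → ℚ) :
    (Q (D - (2 : ℚ) • Δ) = -2 ∧ Q (D - (4 : ℚ) • Δ) = -2) ↔
      ∑ i, D i = 10 ∧ ∑ i, D i ^ 2 = 22 := by
  rw [Q_sub_smul_Δ, Q_sub_smul_Δ]
  constructor
  · rintro ⟨h₁, h₂⟩
    have hs : ∑ i, D i = 10 := by linarith
    rw [hs] at h₁
    exact ⟨hs, by linarith⟩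
  · rintro ⟨hs, hq⟩
    rw [hs, hq]
    norm_num

theorem exists_int_of_inLambda_of_sum_eq_ten {D : Fin 10 → ℚ} (hD : inLambda D)
    (hs : ∑ i, D i = 10) : ∃ d : Fin 10 → ℤ, ∀ i, D i = d i := by
  choose k hk using fun i => hD.2 i 0
  obtain ⟨m, hm⟩ := hD.1 0
  have hsum : ∑ i, D i = ((∑ i, k i : ℤ) : ℚ) + 10 * D 0 := by
    push_cast
    simp only [← hk, Finset.sum_sub_distrib]
    simp
  have hZ : 3 * ∑ i, k i + 10 * m = 30 := by
    have : (3 * ((∑ i, k i : ℤ) : ℚ) + 10 * m) = 30 := by rw [← hm]; linarith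
    exact_mod_cast this
  obtain ⟨l, rfl⟩ : (3 : ℤ) ∣ m := by omega
  refine ⟨fun i => k i + l, fun i => ?_⟩
  have := hk i
  push_cast at hm ⊢
  linarith

theorem exists_perm_of_card_fiber_eq {α β : Type*} [Fintype α] [DecidableEq β] (s : Finset β)
    {f g : α → β} (hf : ∀ i, f i ∈ s) (hg : ∀ i, g i ∈ s)
    (h : ∀ b ∈ s, Finset.card {i | f i = b} = Finset.card {i | g i = b}) :
    ∃ σ : Equiv.Perm α, ∀ i, f (σ i) = g i := by
  have e (b : β) : Nonempty ({i // g i = b} ≃ {i // f i = b}) := by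
    by_cases hb : b ∈ s
    · exact ⟨Fintype.equivOfCardEq (by rw [Fintype.card_subtype, Fintype.card_subtype, h b hb])⟩
    · have : IsEmpty {i // g i = b} := ⟨fun i => hb (i.2 ▸ hg i)⟩
      have : IsEmpty {i // f i = b} := ⟨fun i => hb (i.2 ▸ hf i)⟩
      exact ⟨Equiv.equivOfIsEmpty _ _⟩
  exact ⟨Equiv.ofFiberEquiv fun b => (e b).some, Equiv.ofFiberEquiv_map _⟩

theorem sum_comp_eq_sum_card_fiber {α β : Type*} [Fintype α] [DecidableEq β] {s : Finset β}
    {f : α → β} (hf : ∀ i, f i ∈ s) (φ : β → ℤ) :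
    ∑ i, φ (f i) = ∑ b ∈ s, (Finset.card {i | f i = b} : ℤ) * φ b := by
  rw [← Finset.sum_fiberwise_of_maps_to (fun i _ => hf i)]
  refine Finset.sum_congr rfl fun b _ => ?_
  rw [Finset.sum_congr rfl (g := fun _ => φ b) (by simp +contextual)]
  simp

theorem mem_Icc_of_sums {d : Fin 10 → ℤ} (hs : ∑ i, d i = 10) (hq : ∑ i, d i ^ 2 = 22)
    (i : Fin 10) : d i ∈ Finset.Icc (-2 : ℤ) 4 := by
  have hx : ∑ j, (d j - 1) ^ 2 = 12 := by
    simp only [sub_sq, Finset.sum_add_distrib, Finset.sum_sub_distrib, ← Finset.mul_sum,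
      ← Finset.sum_mul, hs, hq]
    simp
  have := Finset.single_le_sum (f := fun j => (d j - 1) ^ 2) (fun j _ => sq_nonneg _)
    (Finset.mem_univ i)
  rw [hx] at this
  rw [Finset.mem_Icc]
  constructor <;> nlinarith

theorem multiplicities_of_sums {a b c d e f g : ℕ} (h₀ : a + b + c + d + e + f + g = 10)
    (h₁ : 3 * g + 2 * f + e = 3 * a + 2 * b + c)
    (h₂ : 9 * a + 4 * b + c + e + 4 * f + 9 * g = 12) :
    (a = 0 ∧ b = 0 ∧ c = 3 ∧ d = 6 ∧ e = 0 ∧ f = 0 ∧ g = 1) ∨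
    (a = 0 ∧ b = 0 ∧ c = 4 ∧ d = 4 ∧ e = 0 ∧ f = 2 ∧ g = 0) ∨
    (a = 0 ∧ b = 0 ∧ c = 5 ∧ d = 1 ∧ e = 3 ∧ f = 1 ∧ g = 0) ∨
    (a = 0 ∧ b = 1 ∧ c = 2 ∧ d = 4 ∧ e = 2 ∧ f = 1 ∧ g = 0) ∨
    (a = 0 ∧ b = 1 ∧ c = 3 ∧ d = 1 ∧ e = 5 ∧ f = 0 ∧ g = 0) ∨
    (a = 0 ∧ b = 2 ∧ c = 0 ∧ d = 4 ∧ e = 4 ∧ f = 0 ∧ g = 0) ∨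
    (a = 1 ∧ b = 0 ∧ c = 0 ∧ d = 6 ∧ e = 3 ∧ f = 0 ∧ g = 0) := by
  have ha : a ≤ 1 := by omega
  have hb : b ≤ 3 := by omega
  have hf : f ≤ 3 := by omega
  have hg : g ≤ 1 := by omega
  interval_cases a <;> interval_cases g <;> interval_cases b <;> interval_cases f <;>
    first
    | (exfalso; omega)
    | (simp only [true_and, and_true, false_and, and_false, false_or, or_false, zero_ne_one,
        one_ne_zero, OfNat.ofNat_ne_zero, OfNat.ofNat_ne_one, OfNat.zero_ne_ofNat,
        OfNat.one_ne_ofNat]; omega)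

theorem exists_perm_of_sums {d : Fin 10 → ℤ} (hs : ∑ i, d i = 10) (hq : ∑ i, d i ^ 2 = 22) :
    ∃ w ∈ ([![4, 1, 1, 1, 1, 1, 1, 0, 0, 0], ![3, 3, 1, 1, 1, 1, 0, 0, 0, 0],
      ![3, 2, 2, 2, 1, 0, 0, 0, 0, 0], ![3, 2, 2, 1, 1, 1, 1, 0, 0, -1],
      ![2, 2, 2, 2, 2, 1, 0, 0, 0, -1], ![2, 2, 2, 2, 1, 1, 1, 1, -1, -1],
      ![2, 2, 2, 1, 1, 1, 1, 1, 1, -2]] : List (Fin 10 → ℤ)),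
      ∃ σ : Equiv.Perm (Fin 10), ∀ i, d (σ i) = w i := by
  have hmem := mem_Icc_of_sums hs hq
  have hIcc : Finset.Icc (-2 : ℤ) 4 = {-2, -1, 0, 1, 2, 3, 4} := by decide
  have e₀ := sum_comp_eq_sum_card_fiber hmem (fun _ => 1)
  have e₁ := sum_comp_eq_sum_card_fiber hmem (fun x => x)
  have e₂ := sum_comp_eq_sum_card_fiber hmem (fun x => x ^ 2)
  rw [hs] at e₁
  rw [hq] at e₂
  simp [hIcc] at e₀ e₁ e₂
  have perm_of (w : Fin 10 → ℤ) (hw : ∀ i, w i ∈ Finset.Icc (-2 : ℤ) 4)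
      (h : ∀ b ∈ Finset.Icc (-2 : ℤ) 4,
        Finset.card {i | d i = b} = Finset.card {i | w i = b}) :=
    exists_perm_of_card_fiber_eq _ hmem hw h
  rcases multiplicities_of_sums (a := Finset.card {i | d i = -2})
    (b := Finset.card {i | d i = -1}) (c := Finset.card {i | d i = 0})
    (d := Finset.card {i | d i = 1}) (e := Finset.card {i | d i = 2})
    (f := Finset.card {i | d i = 3}) (g := Finset.card {i | d i = 4})
    (by omega) (by omega) (by omega) with h | h | h | h | h | h | h
  all_goals obtain ⟨h₁, h₂, h₃, h₄, h₅, h₆, h₇⟩ := h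
  · refine ⟨![4, 1, 1, 1, 1, 1, 1, 0, 0, 0], by simp, perm_of _ (by decide) ?_⟩
    simp only [hIcc, Finset.forall_mem_insert, Finset.mem_singleton, forall_eq, h₁, h₂, h₃, h₄, h₅,
      h₆, h₇]
    decide
  · refine ⟨![3, 3, 1, 1, 1, 1, 0, 0, 0, 0], by simp, perm_of _ (by decide) ?_⟩
    simp only [hIcc, Finset.forall_mem_insert, Finset.mem_singleton, forall_eq, h₁, h₂, h₃, h₄, h₅,
      h₆, h₇]
    decide
  · refine ⟨![3, 2, 2, 2, 1, 0, 0, 0, 0, 0], by simp, perm_of _ (by decide) ?_⟩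
    simp only [hIcc, Finset.forall_mem_insert, Finset.mem_singleton, forall_eq, h₁, h₂, h₃, h₄, h₅,
      h₆, h₇]
    decide
  · refine ⟨![3, 2, 2, 1, 1, 1, 1, 0, 0, -1], by simp, perm_of _ (by decide) ?_⟩
    simp only [hIcc, Finset.forall_mem_insert, Finset.mem_singleton, forall_eq, h₁, h₂, h₃, h₄, h₅,
      h₆, h₇]
    decide
  · refine ⟨![2, 2, 2, 2, 2, 1, 0, 0, 0, -1], by simp, perm_of _ (by decide) ?_⟩
    simp only [hIcc, Finset.forall_mem_insert, Finset.mem_singleton, forall_eq, h₁, h₂, h₃, h₄, h₅,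
      h₆, h₇]
    decide
  · refine ⟨![2, 2, 2, 2, 1, 1, 1, 1, -1, -1], by simp, perm_of _ (by decide) ?_⟩
    simp only [hIcc, Finset.forall_mem_insert, Finset.mem_singleton, forall_eq, h₁, h₂, h₃, h₄, h₅,
      h₆, h₇]
    decide
  · refine ⟨![2, 2, 2, 1, 1, 1, 1, 1, 1, -2], by simp, perm_of _ (by decide) ?_⟩
    simp only [hIcc, Finset.forall_mem_insert, Finset.mem_singleton, forall_eq, h₁, h₂, h₃, h₄, h₅,
      h₆, h₇]
    decide

/-- Up to permutations of the `Eᵢ`, the Ulrich divisors for `H = 2Δ` are exactly the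
seven listed classes. -/
theorem ulrich_divisors_double_fano (D : Fin 10 → ℚ) (hD : inLambda D) :
    (Q (D - (2 : ℚ) • Δ) = -2 ∧ Q (D - (4 : ℚ) • Δ) = -2) ↔
      ∃ σ : Equiv.Perm (Fin 10),
        (fun i => D (σ i)) = ![(4 : ℚ), 1, 1, 1, 1, 1, 1, 0, 0, 0] ∨
        (fun i => D (σ i)) = ![(3 : ℚ), 3, 1, 1, 1, 1, 0, 0, 0, 0] ∨
        (fun i => D (σ i)) = ![(3 : ℚ), 2, 2, 2, 1, 0, 0, 0, 0, 0] ∨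
        (fun i => D (σ i)) = ![(3 : ℚ), 2, 2, 1, 1, 1, 1, 0, 0, -1] ∨
        (fun i => D (σ i)) = ![(2 : ℚ), 2, 2, 2, 2, 1, 0, 0, 0, -1] ∨
        (fun i => D (σ i)) = ![(2 : ℚ), 2, 2, 2, 1, 1, 1, 1, -1, -1] ∨
        (fun i => D (σ i)) = ![(2 : ℚ), 2, 2, 1, 1, 1, 1, 1, 1, -2] := by
  rw [ulrich_double_fano_iff_sums]
  constructor
  · rintro ⟨hs, hq⟩
    obtain ⟨d, hd⟩ := exists_int_of_inLambda_of_sum_eq_ten hD hs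
    simp only [hd] at hs hq ⊢
    obtain ⟨w, hw, σ, hσ⟩ := exists_perm_of_sums (d := d) (by exact_mod_cast hs)
      (by exact_mod_cast hq)
    refine ⟨σ, ?_⟩
    simp only [hσ]
    simp only [List.mem_cons, List.not_mem_nil, or_false] at hw
    revert hw
    refine Or.imp ?_ <| Or.imp ?_ <| Or.imp ?_ <| Or.imp ?_ <| Or.imp ?_ <| Or.imp ?_ ?_
    all_goals
      rintro rfl
      ext i
      fin_cases i <;> simp
  · rintro ⟨σ, h⟩
    rw [← Equiv.sum_comp σ D, ← Equiv.sum_comp σ (fun i => D i ^ 2)]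
    rcases h with h | h | h | h | h | h | h
    all_goals
      simp only [funext_iff] at h
      simp only [h, Fin.sum_univ_succ, Fin.sum_univ_zero]
      norm_num [Matrix.cons_val_succ, Fin.succ]
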